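/- There is no expansive homeomorphism of the circle. Precisely: there do not exist a homeomorphism f of the circle ℝ/ℤ (with its standard quotient metric) and a constant δ > 0 such that for every pair of distinct points x ≠ y there exists an integer n ∈ ℤ with dist(fⁿ(x), fⁿ(y)) ≥ δ, where fⁿ denotes the n-th iterate of f (negative n meaning iterates of the inverse homeomorphism). -/

import Mathlib

namespace CircleExp

/-- The image of `[u,v]` under `F n` contains two points at distance at least `ε`. -/
def Big {X : Type*} [MetricSpace X] (F : ℤ → ℝ → X) (ε : ℝ) (n : ℤ) (u v : ℝ) : Prop :=
  ∃ x ∈ Set.Icc u v, ∃ y ∈ Set.Icc u v, ε ≤ dist (F n x) (F n y)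

/-- Big at time `n` but small during the `N` previous times. -/
def Good {X : Type*} [MetricSpace X] (F : ℤ → ℝ → X) (ε : ℝ) (N : ℕ) (n : ℤ) (u v : ℝ) : Prop :=
  Big F ε n u v ∧ ∀ i : ℤ, 0 < i → i ≤ N → ¬ Big F ε (n - i) u v

lemma Big.mono {X : Type*} [MetricSpace X] {F : ℤ → ℝ → X} {ε : ℝ} {n : ℤ} {u v u' v' : ℝ}
    (h : Big F ε n u v) (hu : u' ≤ u) (hv : v ≤ v') : Big F ε n u' v' := by
  obtain ⟨x, hx, y, hy, h⟩ := h
  exact ⟨x, ⟨hu.trans hx.1, hx.2.trans hv⟩, y, ⟨hu.trans hy.1, hy.2.trans hv⟩, h⟩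

lemma Big.lt {X : Type*} [MetricSpace X] {F : ℤ → ℝ → X} {ε : ℝ} (hε : 0 < ε) {n : ℤ} {u v : ℝ}
    (h : Big F ε n u v) : ∃ x y, u ≤ x ∧ x < y ∧ y ≤ v ∧ ε ≤ dist (F n x) (F n y) := by
  obtain ⟨x, hx, y, hy, h⟩ := h
  rcases lt_trichotomy x y with h1 | h1 | h1
  · exact ⟨x, y, hx.1, h1, hy.2, h⟩
  · subst h1
    rw [dist_self] at h
    linarith
  · exact ⟨y, x, hy.1, h1, hx.2, by rwa [dist_comm]⟩

lemma step {X : Type*} [MetricSpace X] {F : ℤ → ℝ → X} {ε : ℝ} {N : ℕ}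
    (hunif : ∀ (n : ℤ) (s t : ℝ), ε / 2 ≤ dist (F n s) (F n t) →
      ∃ j : ℤ, |j| ≤ N ∧ ε ≤ dist (F (n + j) s) (F (n + j) t))
    {n : ℤ} {u v x c : ℝ} (hg : Good F ε N n u v) (hu : u ≤ x) (hxc : x ≤ c) (hv : c ≤ v)
    (hd : ε / 2 ≤ dist (F n x) (F n c)) :
    ∃ n' : ℤ, n ≤ n' ∧ n' ≤ n + N ∧ Good F ε N n' x c := by
  classical
  obtain ⟨j, hj, hjd⟩ := hunif n x c hd
  have hb : Big F ε (n + j) x c := ⟨x, ⟨le_rfl, hxc⟩, c, ⟨hxc, le_rfl⟩, hjd⟩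
  rw [abs_le] at hj
  have hj0 : 0 ≤ j := by
    by_contra hneg
    refine hg.2 (-j) (by omega) (by omega) ?_
    rw [sub_neg_eq_add]
    exact hb.mono hu hv
  obtain ⟨j', rfl⟩ := Int.eq_ofNat_of_zero_le hj0
  have hex : ∃ k : ℕ, Big F ε (n + k) x c := ⟨j', hb⟩
  have hle : Nat.find hex ≤ j' := Nat.find_min' hex hb
  refine ⟨n + (Nat.find hex : ℕ), by omega, by omega, Nat.find_spec hex, ?_⟩
  intro i hi0 hiN hbig
  by_cases hik : i ≤ (Nat.find hex : ℕ)
  · refine Nat.find_min hex (m := Nat.find hex - i.toNat) (by omega) ?_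
    convert hbig using 1
    omega
  · refine hg.2 (i - (Nat.find hex : ℕ)) (by omega) (by omega) ?_
    have := hbig.mono hu hv
    convert this using 1
    omega

/-- Parameters in `(u,v)` hitting `P` at a time in `[n, n + kN]`. -/
def Q {X : Type*} (F : ℤ → ℝ → X) (N : ℕ) (P : Set X) (k : ℕ) (n : ℤ) (u v : ℝ) : Set ℝ :=
  {t | t ∈ Set.Ioo u v ∧ ∃ m : ℤ, n ≤ m ∧ m ≤ n + k * N ∧ F m t ∈ P}

lemma lower {X : Type*} [MetricSpace X] {F : ℤ → ℝ → X} {ε : ℝ} (hε : 0 < ε) {N : ℕ}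
    (hcont : ∀ n, Continuous (F n))
    (hunif : ∀ (n : ℤ) (s t : ℝ), ε / 2 ≤ dist (F n s) (F n t) →
      ∃ j : ℤ, |j| ≤ N ∧ ε ≤ dist (F (n + j) s) (F (n + j) t))
    {P : Set X}
    (hP : ∀ g : ℝ → X, Continuous g → ∀ x y, x < y → ε ≤ dist (g x) (g y) →
      ∃ t ∈ Set.Ioo x y, g t ∈ P) (k : ℕ) :
    ∀ (n : ℤ) (u v : ℝ), Good F ε N n u v → (2 ^ k : ℕ∞) ≤ (Q F N P k n u v).encard := by
  induction k with
  | zero =>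
    intro n u v hg
    obtain ⟨x, y, hu, hxy, hv, hd⟩ := hg.1.lt hε
    obtain ⟨t, ht, htP⟩ := hP _ (hcont n) x y hxy hd
    rw [pow_zero, Set.one_le_encard_iff_nonempty]
    exact ⟨t, ⟨hu.trans_lt ht.1, ht.2.trans_le hv⟩, n, le_rfl, by simp, htP⟩
  | succ k ih =>
    intro n u v hg
    obtain ⟨x, y, hu, hxy, hv, hd⟩ := hg.1.lt hε
    have hc : ContinuousOn (fun t => dist (F n x) (F n t)) (Set.Icc x y) :=
      (continuous_const.dist (hcont n)).continuousOn
    obtain ⟨c, hcI, hcd⟩ := intermediate_value_Icc hxy.le hc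
      (show ε / 2 ∈ Set.Icc _ _ from ⟨by rw [dist_self]; linarith, by linarith⟩)
    simp only at hcd
    have hcd2 : ε / 2 ≤ dist (F n c) (F n y) := by
      have := dist_triangle (F n x) (F n c) (F n y)
      linarith
    obtain ⟨n1, h1a, h1b, hg1⟩ := step hunif hg hu hcI.1 (hcI.2.trans hv) hcd.ge
    obtain ⟨n2, h2a, h2b, hg2⟩ := step hunif hg (hu.trans hcI.1) hcI.2 hv hcd2
    have hdisj : Disjoint (Q F N P k n1 x c) (Q F N P k n2 c y) := by
      rw [Set.disjoint_left]
      rintro t ht ht'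
      exact absurd ht.1.2 (not_lt.2 ht'.1.1.le)
    have hsub : Q F N P k n1 x c ∪ Q F N P k n2 c y ⊆ Q F N P (k + 1) n u v := by
      rintro t (⟨ht, m, hm1, hm2, hm⟩ | ⟨ht, m, hm1, hm2, hm⟩)
      · refine ⟨⟨hu.trans_lt ht.1, ht.2.trans_le (hcI.2.trans hv)⟩, m, by omega, ?_, hm⟩
        push_cast
        linarith
      · refine ⟨⟨(hu.trans hcI.1).trans_lt ht.1, ht.2.trans_le hv⟩, m, by omega, ?_, hm⟩
        push_cast
        linarith
    calc (2 ^ (k + 1) : ℕ∞) = 2 ^ k + 2 ^ k := by rw [pow_succ, mul_two]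
      _ ≤ (Q F N P k n1 x c).encard + (Q F N P k n2 c y).encard :=
        add_le_add (ih _ _ _ hg1) (ih _ _ _ hg2)
      _ = (Q F N P k n1 x c ∪ Q F N P k n2 c y).encard := (Set.encard_union_eq hdisj).symm
      _ ≤ _ := Set.encard_le_encard hsub

lemma upper {X : Type*} {F : ℤ → ℝ → X} {N : ℕ} {P : Set X} (hfin : P.Finite) {u v : ℝ}
    (hinj : ∀ n, Set.InjOn (F n) (Set.Icc u v)) (k : ℕ) (n : ℤ) :
    (Q F N P k n u v).encard ≤ ((k * N + 1) * P.ncard : ℕ) := by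
  classical
  have hsub : Q F N P k n u v ⊆
      ⋃ i ∈ Finset.range (k * N + 1), {t | t ∈ Set.Ioo u v ∧ F (n + (i : ℕ)) t ∈ P} := by
    rintro t ⟨ht, m, hm1, hm2, hm⟩
    obtain ⟨i, rfl⟩ : ∃ i : ℕ, m = n + i := ⟨(m - n).toNat, by omega⟩
    simp only [Set.mem_iUnion]
    refine ⟨i, ?_, ht, hm⟩
    rw [Finset.mem_range]
    have : (i : ℤ) ≤ ((k * N : ℕ) : ℤ) := by push_cast; linarith
    omega
  have hone : ∀ i : ℕ, {t | t ∈ Set.Ioo u v ∧ F (n + (i : ℕ)) t ∈ P}.encard ≤ (P.ncard : ℕ) := by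
    intro i
    rw [hfin.cast_ncard_eq]
    apply Set.encard_le_encard_of_injOn (f := F (n + i))
    · intro t ht
      exact ht.2
    · exact (hinj _).mono fun t ht => Set.Ioo_subset_Icc_self ht.1
  refine (Set.encard_le_encard hsub).trans ?_
  have : ∀ s : Finset ℕ, (⋃ i ∈ s, {t | t ∈ Set.Ioo u v ∧ F (n + (i : ℕ)) t ∈ P}).encard
      ≤ (s.card * P.ncard : ℕ) := by
    intro s
    induction s using Finset.induction_on with
    | empty => simp
    | insert a s ha ih =>
      rw [Finset.set_biUnion_insert, Finset.card_insert_of_notMem ha]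
      refine (Set.encard_union_le _ _).trans ?_
      refine (add_le_add (hone a) ih).trans ?_
      norm_cast
      apply le_of_eq
      ring
  simpa using this (Finset.range (k * N + 1))

lemma core {X : Type*} [MetricSpace X] {F : ℤ → ℝ → X} {ε : ℝ} (hε : 0 < ε) {N : ℕ}
    (hcont : ∀ n, Continuous (F n))
    (hunif : ∀ (n : ℤ) (s t : ℝ), ε / 2 ≤ dist (F n s) (F n t) →
      ∃ j : ℤ, |j| ≤ N ∧ ε ≤ dist (F (n + j) s) (F (n + j) t))
    {P : Set X} (hfin : P.Finite)
    (hP : ∀ g : ℝ → X, Continuous g → ∀ x y, x < y → ε ≤ dist (g x) (g y) →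
      ∃ t ∈ Set.Ioo x y, g t ∈ P)
    {u v : ℝ} (hinj : ∀ n, Set.InjOn (F n) (Set.Icc u v))
    (hsmall : ∀ i : ℤ, |i| ≤ N → ¬ Big F ε i u v) (n : ℕ) (hbig : Big F ε n u v) : False := by
  classical
  have hex : ∃ k : ℕ, Big F ε k u v := ⟨n, hbig⟩
  have hg : Good F ε N (Nat.find hex : ℕ) u v := by
    refine ⟨Nat.find_spec hex, ?_⟩
    intro i hi0 hiN hb
    by_cases hik : i ≤ (Nat.find hex : ℕ)
    · refine Nat.find_min hex (m := Nat.find hex - i.toNat) (by omega) ?_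
      convert hb using 1
      omega
    · exact hsmall _ (by rw [abs_le]; omega) hb
  have key : ∀ k : ℕ, 2 ^ k ≤ (k * N + 1) * P.ncard := by
    intro k
    have := (lower hε hcont hunif hP k _ _ _ hg).trans (upper hfin hinj k _)
    exact_mod_cast this
  -- exponential beats linear
  have h2 : ∀ k : ℕ, k * k ≤ 2 ^ k * 4 := by
    intro k
    induction k with
    | zero => simp
    | succ k ih =>
      rcases Nat.lt_or_ge k 3 with h | h
      · interval_cases k <;> norm_num
      · rw [pow_succ]; nlinarith
  have hk := key (4 * (N + 1) * P.ncard + 1)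
  have hk2 := h2 (4 * (N + 1) * P.ncard + 1)
  set p := P.ncard
  set k := 4 * (N + 1) * p + 1 with hkdef
  have h3 : k * k ≤ (k * N + 1) * p * 4 := hk2.trans (Nat.mul_le_mul_right 4 hk)
  have hk1 : 1 ≤ k := by omega
  have h4 : (k * N + 1) * p * 4 ≤ k * (4 * (N + 1) * p) := by
    calc (k * N + 1) * p * 4 ≤ (k * N + k) * p * 4 := by gcongr
      _ = _ := by ring
  have h5 : k * (4 * (N + 1) * p) < k * k := Nat.mul_lt_mul_of_pos_left (by omega) (by omega)
  omega

lemma sphere_finite (c : AddCircle (1 : ℝ)) (r : ℝ) :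
    {x : AddCircle (1 : ℝ) | dist x c = r}.Finite := by
  refine ((Set.toFinite {((r : ℝ) : AddCircle (1 : ℝ)), ((-r : ℝ) : AddCircle (1 : ℝ))}).image
    (fun z => z + c)).subset ?_
  intro x hx
  refine ⟨x - c, ?_, by simp⟩
  rw [Set.mem_setOf_eq, dist_eq_norm] at hx
  generalize x - c = z at hx
  obtain ⟨t, ht⟩ : ∃ t : ℝ, (t : AddCircle (1 : ℝ)) = z := QuotientAddGroup.mk_surjective z
  have hn : ‖z‖ = |t - round t| := by
    rw [← ht, AddCircle.norm_eq]; simp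
  have hz : ((t - round t : ℝ) : AddCircle (1 : ℝ)) = z := by
    rw [← ht, AddCircle.coe_sub]
    have : ((round t : ℝ) : AddCircle (1 : ℝ)) = 0 := by
      rw [AddCircle.coe_eq_zero_iff]; exact ⟨round t, by simp⟩
    rw [this, sub_zero]
  rw [hn] at hx
  rcases abs_choice (t - round t) with h | h
  · left; rw [← hz, ← hx, h]
  · right
    rw [Set.mem_singleton_iff, ← hz, ← hx, h, neg_neg]

lemma exists_P {ε : ℝ} (hε : 0 < ε) : ∃ P : Set (AddCircle (1 : ℝ)), P.Finite ∧
    ∀ g : ℝ → AddCircle (1 : ℝ), Continuous g → ∀ x y, x < y → ε ≤ dist (g x) (g y) →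
      ∃ t ∈ Set.Ioo x y, g t ∈ P := by
  obtain ⟨s, -, hsf, hs⟩ := Metric.totallyBounded_iff.1
    (isCompact_univ (X := AddCircle (1 : ℝ))).totallyBounded (ε / 4) (by linarith) |>.imp
      (fun s h => (⟨trivial, h.1, h.2⟩ : True ∧ _ ∧ _))
  refine ⟨⋃ c ∈ s, {x | dist x c = ε / 4}, hsf.biUnion fun c _ => sphere_finite c _, ?_⟩
  intro g hg x y hxy hd
  have := hs (Set.mem_univ (g x))
  simp only [Set.mem_iUnion, Metric.mem_ball] at this
  obtain ⟨c, hc, hxc⟩ := this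
  have hyc : ε / 4 < dist (g y) c := by
    have := dist_triangle_right (g x) (g y) c
    linarith
  obtain ⟨t, ht, htd⟩ := intermediate_value_Ioo hxy.le
    (f := fun t => dist (g t) c) (hg.dist continuous_const).continuousOn ⟨hxc, hyc⟩
  refine ⟨t, ht, ?_⟩
  simp only [Set.mem_iUnion]
  exact ⟨c, hc, htd⟩

lemma cont_zpow {X : Type*} [TopologicalSpace X] (f : X ≃ₜ X) (n : ℤ) :
    Continuous (f.toEquiv ^ n : Equiv.Perm X) := by
  have h1 : ∀ (e : Equiv.Perm X), Continuous e → ∀ k : ℕ, Continuous (e ^ k : Equiv.Perm X) := by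
    intro e he k
    rw [Equiv.Perm.coe_pow]
    exact he.iterate k
  obtain ⟨k, rfl | rfl⟩ := Int.eq_nat_or_neg n
  · rw [zpow_natCast]; exact h1 _ f.continuous k
  · rw [zpow_neg, zpow_natCast, ← inv_pow]; exact h1 _ f.symm.continuous k

lemma unif {X : Type*} [MetricSpace X] [CompactSpace X] (f : X ≃ₜ X) {δ ε : ℝ} (hε : 0 < ε)
    (hεδ : ε < δ)
    (h : ∀ x y : X, x ≠ y → ∃ n : ℤ, δ ≤ dist ((f.toEquiv ^ n) x) ((f.toEquiv ^ n) y)) :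
    ∃ N : ℕ, ∀ x y : X, ε / 2 ≤ dist x y → ∃ j : ℤ, |j| ≤ N ∧
      ε ≤ dist ((f.toEquiv ^ j) x) ((f.toEquiv ^ j) y) := by
  have hK : IsCompact {p : X × X | ε / 2 ≤ dist p.1 p.2} :=
    (isClosed_le continuous_const continuous_dist).isCompact
  obtain ⟨t, ht⟩ := hK.elim_finite_subcover
    (fun j : ℤ => {p : X × X | ε < dist ((f.toEquiv ^ j) p.1) ((f.toEquiv ^ j) p.2)})
    (fun j => isOpen_lt continuous_const
      (((cont_zpow f j).comp continuous_fst).dist ((cont_zpow f j).comp continuous_snd)))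
    (by
      rintro ⟨x, y⟩ hxy
      have hne : x ≠ y := by
        rintro rfl
        simp only [Set.mem_setOf_eq, dist_self] at hxy
        linarith
      obtain ⟨n, hn⟩ := h x y hne
      exact Set.mem_iUnion.2 ⟨n, hεδ.trans_le hn⟩)
  refine ⟨t.sup Int.natAbs, fun x y hxy => ?_⟩
  have := ht (show (x, y) ∈ _ from hxy)
  simp only [Set.mem_iUnion] at this
  obtain ⟨j, hj, hd⟩ := this
  refine ⟨j, ?_, le_of_lt hd⟩
  have := Finset.le_sup (f := Int.natAbs) hj
  rw [Int.abs_eq_natAbs]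
  exact_mod_cast this

end CircleExp

open CircleExp in
/-- There is no expansive homeomorphism of the circle ℝ/ℤ: there do not exist a
homeomorphism `f` of `AddCircle (1 : ℝ)` and a constant `δ > 0` such that for all
distinct `x ≠ y` some iterate `f.toEquiv ^ n` (with `n : ℤ`, negative powers being
iterates of the inverse homeomorphism) separates them to distance at least `δ`. -/
theorem no_expansive_homeomorphism_of_circle :
    ¬ ∃ (f : AddCircle (1 : ℝ) ≃ₜ AddCircle (1 : ℝ)) (δ : ℝ), 0 < δ ∧
      ∀ x y : AddCircle (1 : ℝ), x ≠ y →
        ∃ n : ℤ, δ ≤ dist ((f.toEquiv ^ n) x) ((f.toEquiv ^ n) y) := by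
  rintro ⟨f, δ, hδ, h⟩
  obtain ⟨ε, hε, hεδ⟩ := exists_between hδ
  obtain ⟨N, hN⟩ := unif f hε hεδ h
  obtain ⟨P, hfin, hP⟩ := exists_P hε
  let F : ℤ → ℝ → AddCircle (1 : ℝ) := fun n t => (f.toEquiv ^ n) (t : AddCircle (1 : ℝ))
  have hcont : ∀ n, Continuous (F n) := fun n =>
    (cont_zpow f n).comp (AddCircle.continuous_mk' 1)
  have hunif : ∀ (n : ℤ) (s t : ℝ), ε / 2 ≤ dist (F n s) (F n t) →
      ∃ j : ℤ, |j| ≤ N ∧ ε ≤ dist (F (n + j) s) (F (n + j) t) := by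
    intro n s t hst
    obtain ⟨j, hj, hd⟩ := hN _ _ hst
    refine ⟨j, hj, ?_⟩
    simp only [F] at hd ⊢
    rw [← Equiv.Perm.mul_apply, ← Equiv.Perm.mul_apply, ← zpow_add] at hd
    rwa [add_comm n j]
  -- a tiny arc
  have hev : ∀ᶠ t in nhds (0 : ℝ), ∀ i ∈ Finset.Icc (-(N : ℤ)) N, dist (F i t) (F i 0) < ε / 2 := by
    rw [Filter.eventually_all_finset]
    intro i _
    exact (hcont i).continuousAt.eventually (Metric.ball_mem_nhds _ (half_pos hε))
  obtain ⟨ρ, hρ, hball⟩ := Metric.eventually_nhds_iff.1 hev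
  obtain ⟨b, hb0, hb⟩ := exists_between (lt_min hρ (show (0 : ℝ) < 1 / 2 by norm_num))
  have hbρ := hb.trans_le (min_le_left _ _)
  have hb2 := hb.trans_le (min_le_right _ _)
  have hinj0 : Set.InjOn (fun t : ℝ => (t : AddCircle (1 : ℝ))) (Set.Icc 0 b) := by
    intro s hs t ht hst
    have h0 : ((s - t : ℝ) : AddCircle (1 : ℝ)) = 0 := by
      rw [AddCircle.coe_sub]; exact sub_eq_zero.2 hst
    rw [AddCircle.coe_eq_zero_iff] at h0
    obtain ⟨m, hm⟩ := h0
    simp only [zsmul_eq_mul, mul_one] at hm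
    have hm1 : (m : ℝ) < 1 := by linarith [hs.2, ht.1]
    have hm2 : (-1 : ℝ) < m := by linarith [ht.2, hs.1]
    have : m = 0 := by
      have h1 : m < 1 := by exact_mod_cast hm1
      have h2 : -1 < m := by exact_mod_cast hm2
      omega
    rw [this] at hm
    push_cast at hm
    linarith
  have hinj : ∀ n, Set.InjOn (F n) (Set.Icc 0 b) := fun n =>
    ((f.toEquiv ^ n).injective.injOn (s := Set.univ)).comp hinj0 (fun _ _ => trivial)
  have hsmall : ∀ i : ℤ, |i| ≤ N → ¬ Big F ε i 0 b := by
    rintro i hi ⟨x, hx, y, hy, hd⟩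
    have hi' : i ∈ Finset.Icc (-(N : ℤ)) N := by rw [Finset.mem_Icc]; exact abs_le.1 hi
    have hd0 : ∀ z ∈ Set.Icc 0 b, dist z 0 < ρ := by
      intro z hz
      rw [Real.dist_eq, sub_zero, abs_of_nonneg hz.1]
      linarith [hz.2]
    have h1 := hball (hd0 x hx) i hi'
    have h2 := hball (hd0 y hy) i hi'
    have := dist_triangle_right (F i x) (F i y) (F i 0)
    linarith
  have hne : ((0 : ℝ) : AddCircle (1 : ℝ)) ≠ (b : AddCircle (1 : ℝ)) := fun he =>
    hb0.ne (hinj0 ⟨le_rfl, hb0.le⟩ ⟨hb0.le, le_rfl⟩ he)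
  obtain ⟨n, hn⟩ := h _ _ hne
  have hbig : Big F ε n 0 b := ⟨0, ⟨le_rfl, hb0.le⟩, b, ⟨hb0.le, le_rfl⟩, hεδ.le.trans hn⟩
  obtain ⟨k, rfl | rfl⟩ := Int.eq_nat_or_neg n
  · exact core hε hcont hunif hfin hP hinj hsmall k hbig
  · refine core (F := fun n => F (-n)) hε (fun n => hcont _) ?_ hfin hP (fun n => hinj _)
      (fun i hi hB => hsmall (-i) (by rwa [abs_neg]) hB) k hbig
    intro n s t hst
    obtain ⟨j, hj, hd⟩ := hunif (-n) s t hst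
    refine ⟨-j, by rwa [abs_neg], ?_⟩
    rwa [show -(n + -j) = -n + j by ring]
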